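/- For all n_0 ∈ ℕ and 𝐧 ∈ ℕ^r, the function F(n_0,𝐧) = lim_{m→∞} dim_𝕜( 𝐉_{m𝐧} / I_{m n_0} 𝐉_{m𝐧} ) / m^d satisfies F(n_0,𝐧) = Vol_d(Δ(Γ_{n_0,𝐧})) − Vol_d(Δ(Γ̂_{n_0,𝐧})), where Δ(S) = Con(S) ∩ π^{-1}(1), Con(S) is the closure in ℝ^{d+1} of the set of all nonnegative real linear combinations of elements of S, and Vol_d(Δ(S)) is the d-dimensional Lebesgue volume of π_1(Δ(S)). -/

import Mathlib

open Filter MvPolynomial Pointwise MeasureTheory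

noncomputable section

/-- The graded irrelevant (maximal graded) ideal `𝔪 = (x_1, …, x_d)` of `𝕜[x_1, …, x_d]`. -/
def mId (𝕜 : Type*) [Field 𝕜] (d : ℕ) : Ideal (MvPolynomial (Fin d) 𝕜) :=
  Ideal.span (Set.range MvPolynomial.X)

/-- A graded family of ideals: `I 0 = R` and `I i * I j ⊆ I (i + j)`. -/
def IsGradedFamily {R : Type*} [CommSemiring R] (I : ℕ → Ideal R) : Prop :=
  I 0 = ⊤ ∧ ∀ i j : ℕ, I i * I j ≤ I (i + j)

/-- An `𝔪`-primary ideal of the polynomial ring: a proper ideal containing a power of `𝔪`. -/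
def IsMPrimary {𝕜 : Type*} [Field 𝕜] {d : ℕ} (I : Ideal (MvPolynomial (Fin d) 𝕜)) : Prop :=
  I ≠ ⊤ ∧ ∃ k : ℕ, mId 𝕜 d ^ k ≤ I

/-- A monomial ideal: an ideal generated by monomials. -/
def IsMonomialIdeal {𝕜 : Type*} [Field 𝕜] {d : ℕ} (I : Ideal (MvPolynomial (Fin d) 𝕜)) : Prop :=
  ∃ S : Set (Fin d →₀ ℕ), I = Ideal.span ((fun m => MvPolynomial.monomial m (1 : 𝕜)) '' S)

/-- A nonzero monomial ideal generated by monomials of degree at most `b`;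
for nonzero monomial ideals this is exactly the condition `β(I) ≤ b`. -/
def IsMonomialBounded {𝕜 : Type*} [Field 𝕜] {d : ℕ} (I : Ideal (MvPolynomial (Fin d) 𝕜))
    (b : ℕ) : Prop :=
  I ≠ ⊥ ∧ ∃ S : Set (Fin d →₀ ℕ), (∀ m ∈ S, (∑ j, m j) ≤ b) ∧
    I = Ideal.span ((fun m => MvPolynomial.monomial m (1 : 𝕜)) '' S)

/-- The `𝕜`-vector space dimension of the quotient `A / (A ⊓ B)`; for `B ⊆ A`
this is `dim_𝕜 (A / B)`. -/
def quotDim (𝕜 : Type*) [Field 𝕜] {R : Type*} [CommRing R] [Algebra 𝕜 R]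
    (A B : Ideal R) : ℕ :=
  Module.finrank 𝕜
    (↥(Submodule.restrictScalars 𝕜 A) ⧸
      Submodule.comap (Submodule.restrictScalars 𝕜 A).subtype (Submodule.restrictScalars 𝕜 B))

/-- The semigroup `Γ_{n₀,𝐧} = {(𝐦,m) ∈ ℕ^d × ℕ : x^𝐦 ∈ 𝐉_{m𝐧}, |𝐦| ≤ c m (n₀+|𝐧|)}`. -/
def GammaSet (𝕜 : Type*) [Field 𝕜] {d r : ℕ}
    (J : Fin r → ℕ → Ideal (MvPolynomial (Fin d) 𝕜)) (c n0 : ℕ) (n : Fin r → ℕ) :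
    Set ((Fin d →₀ ℕ) × ℕ) :=
  {q | MvPolynomial.monomial q.1 (1 : 𝕜) ∈ ∏ i, J i (q.2 * n i) ∧
    (∑ j, q.1 j) ≤ c * q.2 * (n0 + ∑ i, n i)}

/-- The semigroup `Γ̂_{n₀,𝐧} = {(𝐦,m) : x^𝐦 ∈ I_{m n₀}𝐉_{m𝐧}, |𝐦| ≤ c m (n₀+|𝐧|)}`. -/
def GammaHatSet (𝕜 : Type*) [Field 𝕜] {d r : ℕ}
    (I : ℕ → Ideal (MvPolynomial (Fin d) 𝕜))
    (J : Fin r → ℕ → Ideal (MvPolynomial (Fin d) 𝕜)) (c n0 : ℕ) (n : Fin r → ℕ) :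
    Set ((Fin d →₀ ℕ) × ℕ) :=
  {q | MvPolynomial.monomial q.1 (1 : 𝕜) ∈ I (q.2 * n0) * ∏ i, J i (q.2 * n i) ∧
    (∑ j, q.1 j) ≤ c * q.2 * (n0 + ∑ i, n i)}

/-- The level set `π₁([S]_m)` of a subset `S ⊆ ℕ^d × ℕ`. -/
def levelSet {d : ℕ} (S : Set ((Fin d →₀ ℕ) × ℕ)) (m : ℕ) : Set (Fin d →₀ ℕ) :=
  {q | (q, m) ∈ S}

/-- The embedding `ℕ^d × ℕ → ℝ^d × ℝ`. -/
def embedReal {d : ℕ} (q : (Fin d →₀ ℕ) × ℕ) : (Fin d → ℝ) × ℝ :=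
  ((fun j => (q.1 j : ℝ)), (q.2 : ℝ))

/-- `Con(S)`: the closure of the set of all non-negative real linear combinations of
elements of `S ⊆ ℝ^d × ℝ`. -/
def coneOf {d : ℕ} (S : Set ((Fin d → ℝ) × ℝ)) : Set ((Fin d → ℝ) × ℝ) :=
  closure {x | ∃ (k : ℕ) (a : Fin k → ℝ) (v : Fin k → (Fin d → ℝ) × ℝ),
    (∀ j, 0 ≤ a j) ∧ (∀ j, v j ∈ S) ∧ x = ∑ j, a j • v j}

/-- The Newton–Okounkov body `Δ(S) = Con(S) ∩ π^{-1}(1)` of `S ⊆ ℕ^d × ℕ`,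
where `π` is the projection to the last coordinate. -/
def newtonBody {d : ℕ} (S : Set ((Fin d →₀ ℕ) × ℕ)) : Set ((Fin d → ℝ) × ℝ) :=
  {x | x ∈ coneOf (embedReal '' S) ∧ x.2 = 1}

/-- `Vol_d(Δ(S))`: the `d`-dimensional Lebesgue volume of `π₁(Δ(S))`. -/
def volDelta {d : ℕ} (S : Set ((Fin d →₀ ℕ) × ℕ)) : ℝ :=
  (MeasureTheory.volume (Prod.fst '' newtonBody S)).toReal

theorem isMonomialIdeal_top {𝕜 : Type*} [Field 𝕜] {d : ℕ} :
    IsMonomialIdeal (⊤ : Ideal (MvPolynomial (Fin d) 𝕜)) := by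
  refine ⟨{0}, ?_⟩
  rw [Set.image_singleton, Eq.comm, Ideal.eq_top_iff_one]
  exact Ideal.subset_span rfl

theorem IsMonomialIdeal.mul {𝕜 : Type*} [Field 𝕜] {d : ℕ}
    {A B : Ideal (MvPolynomial (Fin d) 𝕜)} (hA : IsMonomialIdeal A) (hB : IsMonomialIdeal B) :
    IsMonomialIdeal (A * B) := by
  obtain ⟨S, rfl⟩ := hA
  obtain ⟨T, rfl⟩ := hB
  refine ⟨S + T, ?_⟩
  rw [Ideal.span_mul_span']
  congr 1
  ext f
  simp only [Set.mem_mul, Set.mem_image, Set.mem_add]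
  constructor
  · rintro ⟨_, ⟨a, ha, rfl⟩, _, ⟨b, hb, rfl⟩, rfl⟩
    exact ⟨a + b, ⟨a, ha, b, hb, rfl⟩, by simp [monomial_mul]⟩
  · rintro ⟨_, ⟨a, ha, b, hb, rfl⟩, rfl⟩
    exact ⟨_, ⟨a, ha, rfl⟩, _, ⟨b, hb, rfl⟩, by simp [monomial_mul]⟩

theorem IsMonomialIdeal.prod {𝕜 : Type*} [Field 𝕜] {d : ℕ} {ι : Type*} (s : Finset ι)
    {A : ι → Ideal (MvPolynomial (Fin d) 𝕜)} (hA : ∀ i, IsMonomialIdeal (A i)) :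
    IsMonomialIdeal (∏ i ∈ s, A i) := by
  classical
  induction s using Finset.induction_on with
  | empty => simpa [Ideal.one_eq_top] using isMonomialIdeal_top
  | insert a s ha ih => rw [Finset.prod_insert ha]; exact (hA a).mul ih

theorem IsMonomialIdeal.mem_iff {𝕜 : Type*} [Field 𝕜] {d : ℕ}
    {A : Ideal (MvPolynomial (Fin d) 𝕜)} (hA : IsMonomialIdeal A) (f : MvPolynomial (Fin d) 𝕜) :
    f ∈ A ↔ ∀ m ∈ f.support, monomial m (1 : 𝕜) ∈ A := by
  obtain ⟨S, rfl⟩ := hA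
  simp only [mem_ideal_span_monomial_image]
  simp

theorem monomial_mem_of_le {𝕜 : Type*} [Field 𝕜] {d : ℕ} {A : Ideal (MvPolynomial (Fin d) 𝕜)}
    {a b : Fin d →₀ ℕ} (hab : a ≤ b) (ha : monomial a (1 : 𝕜) ∈ A) :
    monomial b (1 : 𝕜) ∈ A := by
  have h : monomial b (1 : 𝕜) = monomial (b - a) 1 * monomial a 1 := by
    rw [monomial_mul, tsub_add_cancel_of_le hab, one_mul]
  rw [h]
  exact A.mul_mem_left _ ha

theorem monomial_mem_mId_pow {𝕜 : Type*} [Field 𝕜] {d : ℕ} {k : ℕ} {a : Fin d →₀ ℕ}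
    (h : k ≤ ∑ j, a j) : monomial a (1 : 𝕜) ∈ mId 𝕜 d ^ k := by
  refine Ideal.pow_le_pow_right h ?_
  rw [monomial_eq, C_1, one_mul, Finsupp.prod_fintype _ _ (fun _ => pow_zero _),
    ← Finset.prod_pow_eq_pow_sum]
  exact Ideal.prod_mem_prod fun i _ => Ideal.pow_mem_pow (Ideal.subset_span (Set.mem_range_self i)) _

/-- The dimension of a quotient of monomial ideals counts the monomials in the difference. -/
theorem quotDim_eq_ncard {𝕜 : Type*} [Field 𝕜] {d : ℕ} {A B : Ideal (MvPolynomial (Fin d) 𝕜)}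
    (hA : IsMonomialIdeal A) (hB : IsMonomialIdeal B) {T : Set (Fin d →₀ ℕ)} (hT : T.Finite)
    (hmem : ∀ a, a ∈ T ↔ monomial a (1 : 𝕜) ∈ A ∧ monomial a (1 : 𝕜) ∉ B) :
    quotDim 𝕜 A B = T.ncard := by
  classical
  have := hT.fintype
  let φ : (Submodule.restrictScalars 𝕜 A) →ₗ[𝕜] (T → 𝕜) :=
    (LinearMap.pi fun t : T => lcoeff 𝕜 (t : Fin d →₀ ℕ)) ∘ₗ
      (Submodule.restrictScalars 𝕜 A).subtype
  have hφ : ∀ f t, φ f t = coeff (t : Fin d →₀ ℕ) (f : MvPolynomial (Fin d) 𝕜) :=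
    fun f t => rfl
  have hsurj : Function.Surjective φ := by
    intro g
    have hg : ∑ t : T, monomial (t : Fin d →₀ ℕ) (g t) ∈ A :=
      A.sum_mem fun t _ => by
        rw [show monomial (t : Fin d →₀ ℕ) (g t) = C (g t) * monomial (t : Fin d →₀ ℕ) 1 by
          rw [C_mul_monomial, mul_one]]
        exact A.mul_mem_left _ ((hmem t).1 t.2).1
    refine ⟨⟨_, hg⟩, ?_⟩
    ext t
    rw [hφ]
    simp [coeff_sum, coeff_monomial, ← Subtype.ext_iff]
  have hker : LinearMap.ker φ = Submodule.comap (Submodule.restrictScalars 𝕜 A).subtype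
      (Submodule.restrictScalars 𝕜 B) := by
    ext ⟨f, hf⟩
    have hf' : f ∈ A := hf
    simp only [LinearMap.mem_ker, Submodule.mem_comap, Submodule.subtype_apply,
      Submodule.restrictScalars_mem]
    rw [hB.mem_iff]
    constructor
    · intro h m hm
      by_contra hmB
      have hmT : m ∈ T := (hmem m).2 ⟨(hA.mem_iff f).1 hf' m hm, hmB⟩
      exact (mem_support_iff.1 hm) (congrFun h ⟨m, hmT⟩)
    · intro h
      ext t
      rw [hφ]
      by_contra ht
      exact ((hmem t).1 t.2).2 (h _ (mem_support_iff.2 ht))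
  rw [quotDim, ← hker, (φ.quotKerEquivOfSurjective hsurj).finrank_eq, Module.finrank_pi,
    Set.ncard_eq_toFinset_card', Set.toFinset_card]

theorem embedReal_add {d : ℕ} (p q : (Fin d →₀ ℕ) × ℕ) :
    embedReal (p + q) = embedReal p + embedReal q := by
  ext <;> simp [embedReal]

theorem embedReal_nsmul {d : ℕ} (k : ℕ) (p : (Fin d →₀ ℕ) × ℕ) :
    embedReal (k • p) = (k : ℝ) • embedReal p := by
  ext <;> simp [embedReal]

/-- The rational multiples `b⁻¹ • p` of the points `p` of a subsemigroup of `ℕ^d × ℕ`. -/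
def rayMonoid {d : ℕ} (S : AddSubmonoid ((Fin d →₀ ℕ) × ℕ)) :
    AddSubmonoid ((Fin d → ℝ) × ℝ) where
  carrier := {x | ∃ b : ℕ, 0 < b ∧ ∃ p ∈ S, x = (b : ℝ)⁻¹ • embedReal p}
  zero_mem' := ⟨1, one_pos, 0, S.zero_mem, by ext <;> simp [embedReal]⟩
  add_mem' := by
    rintro _ _ ⟨b, hb, p, hp, rfl⟩ ⟨c, hc, q, hq, rfl⟩
    refine ⟨b * c, mul_pos hb hc, c • p + b • q,
      S.add_mem (S.nsmul_mem hp _) (S.nsmul_mem hq _), ?_⟩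
    have hb' : (b : ℝ) ≠ 0 := by positivity
    have hc' : (c : ℝ) ≠ 0 := by positivity
    rw [embedReal_add, embedReal_nsmul, embedReal_nsmul, smul_add, smul_smul, smul_smul]
    congr 2 <;> push_cast <;> field_simp

theorem smul_mem_rayMonoid_closure {d : ℕ} (S : AddSubmonoid ((Fin d →₀ ℕ) × ℕ)) {a : ℝ}
    (ha : 0 ≤ a) {x : (Fin d → ℝ) × ℝ} (hx : x ∈ (rayMonoid S).topologicalClosure) :
    a • x ∈ (rayMonoid S).topologicalClosure := by
  have hinv : ∀ b : ℕ, (b : ℝ)⁻¹ • x ∈ (rayMonoid S).topologicalClosure := by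
    intro b
    rcases Nat.eq_zero_or_pos b with rfl | hb
    · simp
    · refine map_mem_closure (continuous_const_smul ((b : ℝ)⁻¹)) hx ?_
      rintro _ ⟨c, hc, p, hp, rfl⟩
      exact ⟨b * c, mul_pos hb hc, p, hp, by rw [smul_smul]; push_cast; rw [mul_inv]⟩
  have hlim : Tendsto (fun n : ℕ => ((⌊a * (n : ℝ)⌋₊ : ℝ) / (n : ℝ)) • x) atTop
      (nhds (a • x)) :=
    ((tendsto_nat_floor_mul_div_atTop ha).comp tendsto_natCast_atTop_atTop).smul_const x
  refine (rayMonoid S).isClosed_topologicalClosure.mem_of_tendsto hlim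
    (Eventually.of_forall fun n => ?_)
  rw [div_eq_mul_inv, mul_smul, Nat.cast_smul_eq_nsmul]
  exact nsmul_mem (hinv n) _

theorem coneOf_eq_closure_rayMonoid {d : ℕ} (S : AddSubmonoid ((Fin d →₀ ℕ) × ℕ)) :
    coneOf (embedReal '' (S : Set ((Fin d →₀ ℕ) × ℕ))) = (rayMonoid S).topologicalClosure := by
  apply Set.Subset.antisymm
  · refine closure_minimal ?_ (rayMonoid S).isClosed_topologicalClosure
    rintro _ ⟨k, a, v, ha, hv, rfl⟩
    refine sum_mem fun j _ => smul_mem_rayMonoid_closure S (ha j) ?_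
    obtain ⟨p, hp, hpv⟩ := hv j
    exact subset_closure ⟨1, one_pos, p, hp, by simp [hpv]⟩
  · refine closure_mono ?_
    rintro _ ⟨b, hb, p, hp, rfl⟩
    exact ⟨1, fun _ => (b : ℝ)⁻¹, fun _ => embedReal p, fun _ => by positivity,
      fun _ => ⟨p, hp, rfl⟩, by simp⟩

/-- The projection to `ℝ^d` of the Newton–Okounkov body of a subsemigroup of `ℕ^d × ℕ`. -/
def bodySection {d : ℕ} (S : AddSubmonoid ((Fin d →₀ ℕ) × ℕ)) : Set (Fin d → ℝ) :=
  {x | (x, (1 : ℝ)) ∈ (rayMonoid S).topologicalClosure}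

theorem fst_image_newtonBody {d : ℕ} (S : AddSubmonoid ((Fin d →₀ ℕ) × ℕ)) :
    Prod.fst '' newtonBody (S : Set ((Fin d →₀ ℕ) × ℕ)) = bodySection S := by
  ext x
  simp only [newtonBody, coneOf_eq_closure_rayMonoid, bodySection, Set.mem_image,
    Set.mem_ofPred_eq, SetLike.mem_coe]
  constructor
  · rintro ⟨⟨y, t⟩, ⟨hy, ht⟩, rfl⟩
    obtain rfl : t = 1 := ht
    exact hy
  · intro hx
    exact ⟨_, ⟨hx, rfl⟩, rfl⟩

theorem isClosed_bodySection {d : ℕ} (S : AddSubmonoid ((Fin d →₀ ℕ) × ℕ)) :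
    IsClosed (bodySection S) :=
  (rayMonoid S).isClosed_topologicalClosure.preimage (by fun_prop : Continuous
    fun x : Fin d → ℝ => (x, (1 : ℝ)))

theorem convex_bodySection {d : ℕ} (S : AddSubmonoid ((Fin d →₀ ℕ) × ℕ)) :
    Convex ℝ (bodySection S) := by
  intro x hx y hy a b ha hb hab
  have h := add_mem (smul_mem_rayMonoid_closure S ha hx) (smul_mem_rayMonoid_closure S hb hy)
  have he : (a • x + b • y, (1 : ℝ)) = a • (x, (1 : ℝ)) + b • (y, (1 : ℝ)) := by
    ext <;> simp [hab]
  rw [← he] at h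
  exact h

theorem div_mem_bodySection {d : ℕ} {S : AddSubmonoid ((Fin d →₀ ℕ) × ℕ)}
    {a : Fin d →₀ ℕ} {n : ℕ} (hn : 0 < n) (h : (a, n) ∈ S) :
    (fun j => (a j : ℝ) / n) ∈ bodySection S := by
  refine subset_closure ⟨n, hn, _, h, ?_⟩
  have hn' : (n : ℝ) ≠ 0 := by positivity
  ext
  · simp [embedReal, div_eq_inv_mul]
  · simp [embedReal, hn']

theorem bodySection_bounds {d K : ℕ} {S : AddSubmonoid ((Fin d →₀ ℕ) × ℕ)}
    (hbd : ∀ p ∈ S, (∑ j, p.1 j) ≤ K * p.2) {x : Fin d → ℝ} (hx : x ∈ bodySection S) :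
    (∀ j, 0 ≤ x j) ∧ ∑ j, x j ≤ K := by
  have hcl : IsClosed {z : (Fin d → ℝ) × ℝ | (∀ j, 0 ≤ z.1 j) ∧ ∑ j, z.1 j ≤ K * z.2} := by
    simp only [Set.ofPred_and, Set.ofPred_forall]
    exact (isClosed_iInter fun j => isClosed_le (by fun_prop) (by fun_prop)).inter
      (isClosed_le (by fun_prop) (by fun_prop))
  have hsub : closure (rayMonoid S : Set ((Fin d → ℝ) × ℝ)) ⊆
      {z : (Fin d → ℝ) × ℝ | (∀ j, 0 ≤ z.1 j) ∧ ∑ j, z.1 j ≤ K * z.2} := by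
    refine closure_minimal ?_ hcl
    rintro _ ⟨b, hb, p, hp, rfl⟩
    refine ⟨fun j => by simp [embedReal]; positivity, ?_⟩
    have h : ((∑ j, p.1 j : ℕ) : ℝ) ≤ ((K * p.2 : ℕ) : ℝ) := by exact_mod_cast hbd p hp
    push_cast at h
    simp only [embedReal, Prod.smul_fst, Prod.smul_snd, Pi.smul_apply, smul_eq_mul,
      ← Finset.mul_sum]
    calc (b : ℝ)⁻¹ * ∑ j, (p.1 j : ℝ) ≤ (b : ℝ)⁻¹ * (K * p.2) := by gcongr
      _ = K * ((b : ℝ)⁻¹ * p.2) := by ring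
  simpa using hsub hx

/-- A point strictly below a given interior point of the body comes from the semigroup. -/
theorem exists_mem_lt_of_mem_interior {d : ℕ} {S : AddSubmonoid ((Fin d →₀ ℕ) × ℕ)}
    {x : Fin d → ℝ} (hx : x ∈ interior (bodySection S)) :
    ∃ p ∈ S, 0 < p.2 ∧ ∀ j, (p.1 j : ℝ) < p.2 * x j := by
  have hlim : Tendsto (fun ε : ℝ => fun j => x j - ε) (nhdsWithin 0 (Set.Ioi 0)) (nhds x) := by
    have : Continuous fun ε : ℝ => fun j => x j - ε := by fun_prop
    have h := this.tendsto 0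
    simp only [sub_zero] at h
    exact h.mono_left nhdsWithin_le_nhds
  obtain ⟨ε, hε, hε0⟩ := ((hlim.eventually (mem_interior_iff_mem_nhds.1 hx)).and
    self_mem_nhdsWithin).exists
  have hε0 : 0 < ε := hε0
  have hopen : IsOpen {z : (Fin d → ℝ) × ℝ | 0 < z.2 ∧ ∀ j, z.1 j < z.2 * x j} := by
    simp only [Set.ofPred_and, Set.ofPred_forall]
    exact (isOpen_lt (by fun_prop) (by fun_prop)).inter
      (isOpen_iInter_of_finite fun j => isOpen_lt (by fun_prop) (by fun_prop))
  obtain ⟨_, ⟨h0, hlt⟩, b, hb, p, hp, rfl⟩ := mem_closure_iff.1 hε _ hopen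
    ⟨one_pos, fun j => by simp [hε0]⟩
  have hb' : (0 : ℝ) < (b : ℝ)⁻¹ := by positivity
  simp only [embedReal, Prod.smul_fst, Prod.smul_snd, Pi.smul_apply, smul_eq_mul] at h0 hlt
  refine ⟨p, hp, by exact_mod_cast pos_of_mul_pos_right h0 hb'.le, fun j => ?_⟩
  have h := hlt j
  rw [mul_assoc] at h
  exact lt_of_mul_lt_mul_left h hb'.le

theorem eventually_floor_mem_of_mem_interior {d K : ℕ} {S : AddSubmonoid ((Fin d →₀ ℕ) × ℕ)}
    (hbd : ∀ p ∈ S, (∑ j, p.1 j) ≤ K * p.2)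
    (hup : ∀ a b : Fin d →₀ ℕ, ∀ m, (a, m) ∈ S → a ≤ b → (∑ j, b j) ≤ K * m → (b, m) ∈ S)
    (hne : ∀ m, ∃ a, (a, m) ∈ S) {x : Fin d → ℝ} (hx : x ∈ interior (bodySection S)) :
    ∀ᶠ n : ℕ in atTop, (Finsupp.equivFunOnFinite.symm fun j => ⌊(n : ℝ) * x j⌋₊, n) ∈ S := by
  obtain ⟨hx0, hxK⟩ := bodySection_bounds hbd (interior_subset hx)
  obtain ⟨⟨q, M⟩, hq, hM, hlt⟩ := exists_mem_lt_of_mem_interior hx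
  simp only at hM hlt
  choose a ha using hne
  have hev : ∀ j, ∀ᶠ n : ℕ in atTop,
      ((∑ t ∈ Finset.range M, a t j : ℕ) : ℝ) + 1 ≤ n * (x j - q j / M) := by
    intro j
    have hpos : 0 < x j - q j / M := by
      rw [sub_pos, div_lt_iff₀ (by exact_mod_cast hM), mul_comm]
      exact hlt j
    exact (tendsto_natCast_atTop_atTop.atTop_mul_const hpos).eventually_ge_atTop _
  filter_upwards [eventually_all.2 hev] with n hn
  have hmem : ((n / M) • q + a (n % M), n) ∈ S := by
    have h := S.add_mem (S.nsmul_mem hq (n / M)) (ha (n % M))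
    have he : (n / M) • (q, M) + (a (n % M), n % M) = ((n / M) • q + a (n % M), n) := by
      ext
      · simp
      · simp [mul_comm (n / M), Nat.div_add_mod]
    rwa [he] at h
  refine hup _ _ _ hmem ?_ ?_
  · intro j
    simp only [Finsupp.coe_add, Finsupp.coe_smul, Pi.add_apply, Pi.smul_apply, smul_eq_mul,
      Finsupp.equivFunOnFinite_symm_apply_apply]
    refine Nat.le_floor ?_
    have h1 : a (n % M) j ≤ ∑ t ∈ Finset.range M, a t j :=
      Finset.single_le_sum (f := fun t => a t j) (fun _ _ => Nat.zero_le _)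
        (Finset.mem_range.2 (Nat.mod_lt _ hM))
    have h1' : (a (n % M) j : ℝ) ≤ ((∑ t ∈ Finset.range M, a t j : ℕ) : ℝ) := by
      exact_mod_cast h1
    have h2 : ((n / M : ℕ) : ℝ) * q j ≤ (n : ℝ) / M * q j := by
      gcongr
      exact Nat.cast_div_le
    have h3 := hn j
    push_cast at h1' h3 ⊢
    have h4 : (n : ℝ) * (x j - q j / M) = n * x j - n / M * q j := by ring
    linarith
  · have h : ((∑ j, ⌊(n : ℝ) * x j⌋₊ : ℕ) : ℝ) ≤ ((K * n : ℕ) : ℝ) := by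
      push_cast
      calc ∑ j, (⌊(n : ℝ) * x j⌋₊ : ℝ) ≤ ∑ j, (n : ℝ) * x j :=
            Finset.sum_le_sum fun j _ => Nat.floor_le (mul_nonneg n.cast_nonneg (hx0 j))
        _ = n * ∑ j, x j := by rw [Finset.mul_sum]
        _ ≤ n * K := by gcongr
        _ = K * n := mul_comm _ _
    exact_mod_cast h

/-- The union of the boxes `∏ [a_j / n, (a_j + 1) / n)` over the points `a` of level `n`. -/
def levelBoxes {d : ℕ} (S : Set ((Fin d →₀ ℕ) × ℕ)) (n : ℕ) : Set (Fin d → ℝ) :=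
  ⋃ a ∈ levelSet S n, Set.univ.pi fun j => Set.Ico ((a j : ℝ) / n) ((a j + 1 : ℝ) / n)

theorem mem_box_iff {d n : ℕ} (hn : 0 < n) (a : Fin d →₀ ℕ) (x : Fin d → ℝ) :
    (x ∈ Set.univ.pi fun j => Set.Ico ((a j : ℝ) / n) ((a j + 1 : ℝ) / n)) ↔
      (∀ j, 0 ≤ x j) ∧ a = Finsupp.equivFunOnFinite.symm fun j => ⌊(n : ℝ) * x j⌋₊ := by
  have hn' : (0 : ℝ) < n := by exact_mod_cast hn
  simp only [Set.mem_univ_pi, Set.mem_Ico, div_le_iff₀ hn', lt_div_iff₀ hn', DFunLike.ext_iff,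
    Finsupp.equivFunOnFinite_symm_apply_apply, ← forall_and]
  refine forall_congr' fun j => ?_
  rw [mul_comm (x j)]
  constructor
  · rintro ⟨h1, h2⟩
    have h0 : 0 ≤ n * x j := le_trans (by positivity) h1
    exact ⟨nonneg_of_mul_nonneg_right h0 hn', ((Nat.floor_eq_iff h0).2 ⟨h1, h2⟩).symm⟩
  · rintro ⟨h0, h⟩
    exact (Nat.floor_eq_iff (by positivity)).1 h.symm

theorem mem_levelBoxes_iff {d n : ℕ} (S : Set ((Fin d →₀ ℕ) × ℕ)) (hn : 0 < n)
    (x : Fin d → ℝ) : x ∈ levelBoxes S n ↔ (∀ j, 0 ≤ x j) ∧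
      (Finsupp.equivFunOnFinite.symm fun j => ⌊(n : ℝ) * x j⌋₊, n) ∈ S := by
  simp only [levelBoxes, Set.mem_iUnion, mem_box_iff hn, levelSet, Set.mem_ofPred_eq]
  constructor
  · rintro ⟨_, h, h0, rfl⟩
    exact ⟨h0, h⟩
  · rintro ⟨h0, h⟩
    exact ⟨_, h, h0, rfl⟩

theorem finite_levelSet {d K : ℕ} {S : Set ((Fin d →₀ ℕ) × ℕ)}
    (hbd : ∀ p ∈ S, (∑ j, p.1 j) ≤ K * p.2) (n : ℕ) : (levelSet S n).Finite := by
  refine (Set.finite_Iic (Finsupp.equivFunOnFinite.symm fun _ : Fin d => K * n)).subset ?_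
  intro a ha j
  exact (Finset.single_le_sum (f := fun j => a j) (fun _ _ => Nat.zero_le _)
    (Finset.mem_univ j)).trans (hbd _ ha)

theorem measurableSet_levelBoxes {d : ℕ} (S : Set ((Fin d →₀ ℕ) × ℕ)) (n : ℕ) :
    MeasurableSet (levelBoxes S n) :=
  MeasurableSet.biUnion (Set.to_countable _) fun _ _ =>
    MeasurableSet.univ_pi fun _ => measurableSet_Ico

theorem volume_levelBoxes {d : ℕ} {S : Set ((Fin d →₀ ℕ) × ℕ)} {n : ℕ} (hn : 0 < n)
    (hfin : (levelSet S n).Finite) :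
    (volume (levelBoxes S n)).toReal = ((levelSet S n).ncard : ℝ) / (n : ℝ) ^ d := by
  have hvol : ∀ a : Fin d →₀ ℕ, (volume (Set.univ.pi fun j =>
      Set.Ico ((a j : ℝ) / n) ((a j + 1 : ℝ) / n))).toReal = ((n : ℝ) ^ d)⁻¹ := by
    intro a
    rw [Real.volume_pi_Ico_toReal fun j => by dsimp only; gcongr; linarith]
    simp [← sub_div]
  have hU : levelBoxes S n = ⋃ a ∈ hfin.toFinset,
      Set.univ.pi fun j => Set.Ico ((a j : ℝ) / n) ((a j + 1 : ℝ) / n) := by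
    simp [levelBoxes]
  rw [hU, measure_biUnion_finset ?_ fun _ _ => MeasurableSet.univ_pi fun _ => measurableSet_Ico,
    ENNReal.toReal_sum ?_]
  · rw [Finset.sum_congr rfl fun a _ => hvol a, Finset.sum_const, nsmul_eq_mul,
      Set.ncard_eq_toFinset_card _ hfin, div_eq_mul_inv]
  · intro a _
    simp only [Real.volume_pi_Ico]
    exact ENNReal.prod_ne_top fun _ _ => ENNReal.ofReal_ne_top
  · intro a _ b _ hab
    refine Set.disjoint_left.2 fun x hxa hxb => hab ?_
    rw [((mem_box_iff hn a x).1 hxa).2, ((mem_box_iff hn b x).1 hxb).2]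

/-- For a semigroup with bounded levels that are upward closed up to the degree bound, the
number of points of level `n` grows like `n ^ d` times the volume of the Newton–Okounkov body. -/
theorem tendsto_ncard_levelSet {d K : ℕ} (S : AddSubmonoid ((Fin d →₀ ℕ) × ℕ))
    (hbd : ∀ p ∈ S, (∑ j, p.1 j) ≤ K * p.2)
    (hup : ∀ a b : Fin d →₀ ℕ, ∀ m, (a, m) ∈ S → a ≤ b → (∑ j, b j) ≤ K * m → (b, m) ∈ S)
    (hne : ∀ m, ∃ a, (a, m) ∈ S) :
    Tendsto (fun n : ℕ => ((levelSet (S : Set ((Fin d →₀ ℕ) × ℕ)) n).ncard : ℝ) / (n : ℝ) ^ d)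
      atTop (nhds (volDelta (S : Set ((Fin d →₀ ℕ) × ℕ)))) := by
  have hfin : volume (bodySection S) ≠ ⊤ := by
    refine ((Metric.isBounded_Icc (0 : Fin d → ℝ) fun _ => (K : ℝ)).subset
      fun x hx => ?_).measure_lt_top.ne
    obtain ⟨h0, hK⟩ := bodySection_bounds hbd hx
    exact ⟨h0, fun j => (Finset.single_le_sum (fun j _ => h0 j) (Finset.mem_univ j)).trans hK⟩
  have hmain : Tendsto (fun n => volume (levelBoxes (S : Set ((Fin d →₀ ℕ) × ℕ)) n)) atTop
      (nhds (volume (bodySection S))) := by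
    refine tendsto_measure_of_ae_tendsto_indicator atTop (isClosed_bodySection S).measurableSet
      (measurableSet_levelBoxes _) (B := Set.Icc (0 : Fin d → ℝ) fun _ => (K : ℝ) + 1)
      measurableSet_Icc (Metric.isBounded_Icc _ _).measure_lt_top.ne ?_ ?_
    · filter_upwards [eventually_gt_atTop 0] with n hn x hx
      obtain ⟨h0, h⟩ := (mem_levelBoxes_iff _ hn x).1 hx
      refine ⟨h0, fun j => ?_⟩
      have hn1 : (1 : ℝ) ≤ n := by exact_mod_cast hn
      have h1 : ⌊(n : ℝ) * x j⌋₊ ≤ K * n := by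
        refine le_trans ?_ (hbd _ h)
        exact Finset.single_le_sum (f := fun j => ⌊(n : ℝ) * x j⌋₊) (fun _ _ => Nat.zero_le _)
          (Finset.mem_univ j)
      have h2 : (⌊(n : ℝ) * x j⌋₊ : ℝ) ≤ K * n := by exact_mod_cast h1
      have h3 := Nat.lt_floor_add_one ((n : ℝ) * x j)
      have h4 : (n : ℝ) * x j ≤ n * (K + 1) := by linarith
      exact le_of_mul_le_mul_left h4 (by linarith)
    · have hfr : ∀ᵐ x ∂volume, x ∉ frontier (bodySection S) :=
        measure_eq_zero_iff_ae_notMem.1 ((convex_bodySection S).addHaar_frontier volume)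
      filter_upwards [hfr] with x hx
      by_cases hxS : x ∈ bodySection S
      · have hint : x ∈ interior (bodySection S) := by
          by_contra h
          exact hx ⟨subset_closure hxS, h⟩
        filter_upwards [eventually_floor_mem_of_mem_interior hbd hup hne hint,
          eventually_gt_atTop 0] with n hn hn0
        simp only [hxS, iff_true]
        exact (mem_levelBoxes_iff _ hn0 x).2 ⟨(bodySection_bounds hbd hxS).1, hn⟩
      · simp only [hxS, iff_false]
        by_contra hcon
        have hfreq : ∃ᶠ n in atTop, x ∈ levelBoxes (S : Set ((Fin d →₀ ℕ) × ℕ)) n := by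
          simpa [Filter.Frequently] using hcon
        have hfreq' := hfreq.and_eventually (eventually_gt_atTop 0)
        obtain ⟨n₀, hn₀, hn₀'⟩ := hfreq'.exists
        have h0 := ((mem_levelBoxes_iff _ hn₀' x).1 hn₀).1
        have hlim : Tendsto (fun n : ℕ => fun j => (⌊(n : ℝ) * x j⌋₊ : ℝ) / n) atTop
            (nhds x) := by
          refine tendsto_pi_nhds.2 fun j => ?_
          simpa only [Function.comp_def, mul_comm (x j)] using
            (tendsto_nat_floor_mul_div_atTop (h0 j)).comp tendsto_natCast_atTop_atTop
        refine hxS ((isClosed_bodySection S).mem_of_frequently_of_tendsto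
          (hfreq'.mono fun n hn => ?_) hlim)
        exact div_mem_bodySection hn.2 ((mem_levelBoxes_iff _ hn.2 x).1 hn.1).2
  rw [volDelta, fst_image_newtonBody]
  refine ((ENNReal.tendsto_toReal hfin).comp hmain).congr' ?_
  filter_upwards [eventually_gt_atTop 0] with n hn
  exact volume_levelBoxes hn (finite_levelSet hbd n)

theorem IsGradedFamily.comp_mul {R : Type*} [CommSemiring R] {A : ℕ → Ideal R}
    (hA : IsGradedFamily A) (k : ℕ) : IsGradedFamily fun m => A (m * k) :=
  ⟨by simpa using hA.1, fun i j => by simpa only [add_mul] using hA.2 (i * k) (j * k)⟩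

theorem IsGradedFamily.mul {R : Type*} [CommSemiring R] {A B : ℕ → Ideal R}
    (hA : IsGradedFamily A) (hB : IsGradedFamily B) : IsGradedFamily fun m => A m * B m := by
  refine ⟨by simp [hA.1, hB.1], fun i j => ?_⟩
  calc A i * B i * (A j * B j) = A i * A j * (B i * B j) := mul_mul_mul_comm _ _ _ _
    _ ≤ A (i + j) * B (i + j) := Ideal.mul_mono (hA.2 i j) (hB.2 i j)

theorem IsGradedFamily.prod {R : Type*} [CommSemiring R] {ι : Type*} (s : Finset ι)
    {A : ι → ℕ → Ideal R} (hA : ∀ i, IsGradedFamily (A i)) :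
    IsGradedFamily fun m => ∏ i ∈ s, A i m := by
  classical
  induction s using Finset.induction_on with
  | empty => exact ⟨by simp [Ideal.one_eq_top], fun i j => by simp⟩
  | insert a s ha ih =>
    simp only [Finset.prod_insert ha]
    exact (hA a).mul ih

theorem IsMonomialBounded.exists_monomial_mem {𝕜 : Type*} [Field 𝕜] {d b : ℕ}
    {A : Ideal (MvPolynomial (Fin d) 𝕜)} (hA : IsMonomialBounded A b) :
    ∃ a : Fin d →₀ ℕ, monomial a (1 : 𝕜) ∈ A ∧ ∑ j, a j ≤ b := by
  obtain ⟨hbot, S, hS, rfl⟩ := hA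
  rcases S.eq_empty_or_nonempty with rfl | ⟨a, ha⟩
  · simp at hbot
  · exact ⟨a, Ideal.subset_span ⟨a, ha, rfl⟩, hS a ha⟩

/-- The exponents of the monomials of degree at most `K * m` in the `m`-th ideal of a family. -/
def degreeBoundedSet {𝕜 : Type*} [Field 𝕜] {d : ℕ} (A : ℕ → Ideal (MvPolynomial (Fin d) 𝕜))
    (K : ℕ) : Set ((Fin d →₀ ℕ) × ℕ) :=
  {q | monomial q.1 (1 : 𝕜) ∈ A q.2 ∧ ∑ j, q.1 j ≤ K * q.2}

theorem tendsto_ncard_degreeBoundedSet {𝕜 : Type*} [Field 𝕜] {d K : ℕ}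
    {A : ℕ → Ideal (MvPolynomial (Fin d) 𝕜)} (hA : IsGradedFamily A)
    (hne : ∀ m, ∃ a : Fin d →₀ ℕ, monomial a (1 : 𝕜) ∈ A m ∧ ∑ j, a j ≤ K * m) :
    Tendsto (fun m : ℕ => ((levelSet (degreeBoundedSet A K) m).ncard : ℝ) / (m : ℝ) ^ d)
      atTop (nhds (volDelta (degreeBoundedSet A K))) := by
  let S : AddSubmonoid ((Fin d →₀ ℕ) × ℕ) :=
    { carrier := degreeBoundedSet A K
      zero_mem' := ⟨by simp [hA.1], by simp⟩
      add_mem' := by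
        rintro p q ⟨hp, hp'⟩ ⟨hq, hq'⟩
        refine ⟨hA.2 _ _ ?_, ?_⟩
        · have h := Ideal.mul_mem_mul hp hq
          rwa [monomial_mul, one_mul] at h
        · simp only [Prod.fst_add, Prod.snd_add, Finsupp.coe_add, Pi.add_apply,
            Finset.sum_add_distrib, mul_add]
          exact add_le_add hp' hq' }
  exact tendsto_ncard_levelSet S (fun _ hp => hp.2)
    (fun _ _ _ ha hab hb => ⟨monomial_mem_of_le hab ha.1, hb⟩) hne

theorem quotDim_eq_ncard_sub_ncard {𝕜 : Type*} [Field 𝕜] {d K m : ℕ}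
    {A B : ℕ → Ideal (MvPolynomial (Fin d) 𝕜)} (hA : IsMonomialIdeal (A m))
    (hB : IsMonomialIdeal (B m)) (hBA : B m ≤ A m)
    (hcap : ∀ a : Fin d →₀ ℕ, K * m ≤ ∑ j, a j → monomial a (1 : 𝕜) ∈ A m →
      monomial a (1 : 𝕜) ∈ B m) :
    (quotDim 𝕜 (A m) (B m) : ℝ) = (levelSet (degreeBoundedSet A K) m).ncard -
      (levelSet (degreeBoundedSet B K) m).ncard := by
  have hfin := fun A : ℕ → Ideal (MvPolynomial (Fin d) 𝕜) =>
    finite_levelSet (S := degreeBoundedSet A K) (fun _ hp => hp.2) m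
  have hsub : levelSet (degreeBoundedSet B K) m ⊆ levelSet (degreeBoundedSet A K) m :=
    fun _ ha => ⟨hBA ha.1, ha.2⟩
  rw [← Set.cast_ncard_sdiff hsub (hfin A), quotDim_eq_ncard hA hB (hfin A).sdiff]
  intro a
  simp only [degreeBoundedSet, levelSet, Set.mem_sdiff, Set.mem_ofPred]
  constructor
  · rintro ⟨⟨h1, h2⟩, h3⟩
    exact ⟨h1, fun h => h3 ⟨h, h2⟩⟩
  · rintro ⟨h1, h2⟩
    refine ⟨⟨h1, ?_⟩, fun h => h2 h.1⟩
    by_contra hlt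
    exact h2 (hcap a (not_le.1 hlt).le h1)

/-- **The limit `F(n₀,𝐧)` as a difference of volumes of Newton–Okounkov bodies:**
`F(n₀,𝐧) = lim_m dim_𝕜(𝐉_{m𝐧}/I_{m n₀}𝐉_{m𝐧})/m^d = Vol_d(Δ(Γ_{n₀,𝐧})) − Vol_d(Δ(Γ̂_{n₀,𝐧}))`
(in particular the limit exists). -/
theorem statement10 {𝕜 : Type*} [Field 𝕜] (d r : ℕ) (hd : 0 < d)
    (I : ℕ → Ideal (MvPolynomial (Fin d) 𝕜))
    (J : Fin r → ℕ → Ideal (MvPolynomial (Fin d) 𝕜)) (β c : ℕ)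
    (hI : IsGradedFamily I)
    (hImon : ∀ n, IsMonomialIdeal (I n))
    (hIprim : ∀ n, 0 < n → IsMPrimary (I n))
    (hJ : ∀ i, IsGradedFamily (J i))
    (hJb : ∀ i n, IsMonomialBounded (J i n) (β * n))
    (hc : β < c)
    (hcap : ∀ (n0 : ℕ) (n : Fin r → ℕ),
      mId 𝕜 d ^ (c * (n0 + ∑ i, n i)) ⊓ (∏ i, J i (n i)) =
        mId 𝕜 d ^ (c * (n0 + ∑ i, n i)) ⊓ (I n0 * ∏ i, J i (n i))) :
    ∀ (n0 : ℕ) (n : Fin r → ℕ),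
      Tendsto
        (fun m : ℕ =>
          (quotDim 𝕜 (∏ i, J i (m * n i)) (I (m * n0) * ∏ i, J i (m * n i)) : ℝ) /
            (m : ℝ) ^ d)
        atTop
        (nhds (volDelta (GammaSet 𝕜 J c n0 n) - volDelta (GammaHatSet 𝕜 I J c n0 n))) := by
  intro n0 n
  set N := n0 + ∑ i, n i with hN
  have hJmon : ∀ m, IsMonomialIdeal (∏ i, J i (m * n i)) := fun m =>
    IsMonomialIdeal.prod _ fun i => ⟨_, (hJb i (m * n i)).2.choose_spec.2⟩
  have hJgr : IsGradedFamily fun m => ∏ i, J i (m * n i) :=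
    IsGradedFamily.prod Finset.univ fun i => (hJ i).comp_mul (n i)
  have hIJgr : IsGradedFamily fun m => I (m * n0) * ∏ i, J i (m * n i) :=
    (hI.comp_mul n0).mul hJgr
  have hcap' : ∀ m, ∀ a : Fin d →₀ ℕ, c * N * m ≤ ∑ j, a j →
      monomial a (1 : 𝕜) ∈ ∏ i, J i (m * n i) →
      monomial a (1 : 𝕜) ∈ I (m * n0) * ∏ i, J i (m * n i) := by
    intro m a ha hmem
    have h := hcap (m * n0) fun i => m * n i
    rw [← Finset.mul_sum, ← mul_add, ← hN] at h
    have ha' : c * (m * N) ≤ ∑ j, a j := by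
      rwa [mul_comm m N, ← mul_assoc]
    exact (h.le ⟨monomial_mem_mId_pow ha', hmem⟩).2
  have hJle : ∀ m, ∃ a : Fin d →₀ ℕ, monomial a (1 : 𝕜) ∈ ∏ i, J i (m * n i) ∧
      ∑ j, a j = c * N * m := by
    intro m
    choose s hs hsb using fun i => (hJb i (m * n i)).exists_monomial_mem
    have hsum : ∑ j, (∑ i, s i) j ≤ c * N * m := by
      calc ∑ j, (∑ i, s i) j = ∑ i, ∑ j, s i j := by
            simp only [Finsupp.coe_finsetSum, Finset.sum_apply]
            exact Finset.sum_comm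
        _ ≤ ∑ i, β * (m * n i) := Finset.sum_le_sum fun i _ => hsb i
        _ = β * (m * ∑ i, n i) := by rw [← Finset.mul_sum, ← Finset.mul_sum]
        _ ≤ c * (m * N) := by
            gcongr
            exact Nat.le_add_left _ _
        _ = c * N * m := by ring
    refine ⟨(∑ i, s i) + Finsupp.single ⟨0, hd⟩ (c * N * m - ∑ j, (∑ i, s i) j),
      monomial_mem_of_le (le_self_add : ∑ i, s i ≤ _) ?_, ?_⟩
    · rw [monomial_sum_one]
      exact Ideal.prod_mem_prod fun i _ => hs i
    · simp only [Finsupp.coe_add, Pi.add_apply, Finset.sum_add_distrib]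
      rw [Finset.sum_eq_single_of_mem (⟨0, hd⟩ : Fin d) (Finset.mem_univ _)
        fun j _ hj => Finsupp.single_eq_of_ne hj, Finsupp.single_eq_same]
      exact Nat.add_sub_cancel' hsum
  have hΓ : GammaSet 𝕜 J c n0 n =
      degreeBoundedSet (fun m => ∏ i, J i (m * n i)) (c * N) := by
    ext q
    rw [GammaSet, degreeBoundedSet, Set.mem_ofPred, Set.mem_ofPred, mul_right_comm]
  have hΓ' : GammaHatSet 𝕜 I J c n0 n =
      degreeBoundedSet (fun m => I (m * n0) * ∏ i, J i (m * n i)) (c * N) := by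
    ext q
    rw [GammaHatSet, degreeBoundedSet, Set.mem_ofPred, Set.mem_ofPred, mul_right_comm]
  rw [hΓ, hΓ']
  refine ((tendsto_ncard_degreeBoundedSet hJgr fun m => ?_).sub
    (tendsto_ncard_degreeBoundedSet hIJgr fun m => ?_)).congr fun m => ?_
  · obtain ⟨a, ha, hsum⟩ := hJle m
    exact ⟨a, ha, hsum.le⟩
  · obtain ⟨a, ha, hsum⟩ := hJle m
    exact ⟨a, hcap' m a hsum.ge ha, hsum.le⟩
  rw [← sub_div, quotDim_eq_ncard_sub_ncard (A := fun m => ∏ i, J i (m * n i))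
    (B := fun m => I (m * n0) * ∏ i, J i (m * n i)) (hJmon m) ((hImon _).mul (hJmon m))
    Ideal.mul_le_right (hcap' m)]
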